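/- The topological spaces s_* and s̃ are homeomorphic; consequently s_* is homeomorphic to K^ℕ with the Tychonoff product topology. -/

import Mathlib

open Filter

noncomputable section

variable (K : Type*) [NontriviallyNormedField K] [IsUltrametricDist K] [CompleteSpace K]
  [LocallyCompactSpace K]

/-- `s̃ = ∏_{j=1}^∞ (B \ {1})`, where `B` is the closed unit ball of `K`, with the
Tychonoff product topology. -/
abbrev sTilde : Type _ := ℕ → ↥(Metric.closedBall (0 : K) 1 \ {1})

/-- `s_* = {y ∈ s̃ : limₘ (1−y_m)⋯(1−y₁) = 0} \ ⋃ₙ {y ∈ s̃ : y_k = 0 ∀ k > n}`. -/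
def sStar : Set (sTilde K) :=
  {y | Tendsto (fun m => ∏ j ∈ Finset.range m, (1 - (y j : K))) atTop (nhds 0)} \
    ⋃ n : ℕ, {y | ∀ k, n ≤ k → (y k : K) = 0}

section Blocks

variable {D : Type*} {P : D → Prop}

/-- A block: a finite word of letters that fail `P`, followed by one letter that satisfies `P`. -/
abbrev Block (P : D → Prop) : Type _ := List {d // ¬ P d} × {d // P d}

/-- Put the letter `d` in front of the sequence `s`. -/
def prependLetter (d : D) (s : ℕ → D) : ℕ → D
  | 0 => d
  | j + 1 => s j

/-- Put the letters of the word `l`, and then the letter `b`, in front of the sequence `s`. -/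
def prependWord : List {d // ¬ P d} → {d // P d} → (ℕ → D) → ℕ → D
  | [], b, s => prependLetter b s
  | a :: l, b, s => prependLetter a (prependWord l b s)

/-- Put the letters of a block in front of a sequence. -/
def prependBlock (w : Block P) (s : ℕ → D) : ℕ → D := prependWord w.1 w.2 s

theorem prependWord_length (l : List {d // ¬ P d}) (b : {d // P d}) (s : ℕ → D) :
    prependWord l b s l.length = b := by
  induction l with
  | nil => rfl
  | cons a l ih => exact ih

theorem prependWord_add_length (l : List {d // ¬ P d}) (b : {d // P d}) (s : ℕ → D) (j : ℕ) :
    prependWord l b s (j + l.length + 1) = s j := by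
  induction l with
  | nil => rfl
  | cons a l ih => exact ih

theorem prependWord_agree (l : List {d // ¬ P d}) (b : {d // P d}) {s t : ℕ → D} {n : ℕ}
    (h : ∀ j < n, s j = t j) : ∀ j < n + 1, prependWord l b s j = prependWord l b t j := by
  induction l with
  | nil =>
    rintro (_ | j) hj
    · rfl
    · exact h j (by omega)
  | cons a l ih =>
    rintro (_ | j) hj
    · rfl
    · exact ih j (by omega)

theorem prependWord_inj {l l' : List {d // ¬ P d}} {b b' : {d // P d}} {s s' : ℕ → D}
    (h : prependWord l b s = prependWord l' b' s') : l = l' ∧ b = b' ∧ s = s' := by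
  induction l generalizing l' with
  | nil =>
    cases l' with
    | nil => exact ⟨rfl, Subtype.ext (congrFun h 0), funext fun j => congrFun h (j + 1)⟩
    | cons a' l' => exact absurd b.2 ((show (b : D) = a' from congrFun h 0) ▸ a'.2)
  | cons a l ih =>
    cases l' with
    | nil => exact absurd b'.2 ((show (a : D) = b' from congrFun h 0) ▸ a.2)
    | cons a' l' =>
      obtain ⟨rfl, hb, hs⟩ := ih (l' := l') (funext fun j => congrFun h (j + 1))
      exact ⟨by rw [Subtype.ext (congrFun h 0 : (a : D) = a')], hb, hs⟩

theorem prependBlock_inj {w w' : Block P} {s s' : ℕ → D}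
    (h : prependBlock w s = prependBlock w' s') : w = w' ∧ s = s' := by
  obtain ⟨h₁, h₂, h₃⟩ := prependWord_inj h
  exact ⟨Prod.ext h₁ h₂, h₃⟩

theorem exists_eq_prependBlock {s : ℕ → D} (h : ∃ j, P (s j)) :
    ∃ (w : Block P) (t : ℕ → D), s = prependBlock w t := by
  obtain ⟨j, hj⟩ := h
  induction j generalizing s with
  | zero =>
    refine ⟨([], ⟨s 0, hj⟩), fun j => s (j + 1), funext ?_⟩
    rintro (_ | j) <;> rfl
  | succ j ih =>
    by_cases h0 : P (s 0)
    · refine ⟨([], ⟨s 0, h0⟩), fun j => s (j + 1), funext ?_⟩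
      rintro (_ | j) <;> rfl
    · obtain ⟨⟨l, b⟩, t, ht⟩ := ih (s := fun j => s (j + 1)) hj
      refine ⟨(⟨s 0, h0⟩ :: l, b), t, funext ?_⟩
      rintro (_ | j)
      · rfl
      · exact congrFun ht j

theorem eq_prependWord_of_agree (l : List {d // ¬ P d}) (b : {d // P d}) {s t : ℕ → D}
    (h : ∀ j ≤ l.length, s j = prependWord l b t j) :
    s = prependWord l b fun j => s (j + l.length + 1) := by
  induction l generalizing s with
  | nil =>
    funext j
    cases j with
    | zero => exact h 0 le_rfl
    | succ j => rfl
  | cons a l ih =>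
    funext j
    cases j with
    | zero => exact h 0 (Nat.zero_le _)
    | succ j =>
      exact congrFun (ih (s := fun j => s (j + 1)) fun j hj => h (j + 1) (Nat.succ_le_succ hj)) j

variable (P) in
/-- The sequences that satisfy `P` infinitely often. -/
abbrev FrequentSeq : Type _ := {s : ℕ → D // ∃ᶠ j in atTop, P (s j)}

theorem frequently_of_prependBlock {w : Block P} {t : ℕ → D}
    (h : ∃ᶠ j in atTop, P (prependBlock w t j)) : ∃ᶠ j in atTop, P (t j) := by
  rw [frequently_atTop] at h ⊢
  intro N
  obtain ⟨j, hj, hP⟩ := h (N + w.1.length + 1)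
  obtain ⟨i, rfl⟩ := Nat.exists_eq_add_of_le hj
  refine ⟨N + i, by omega, ?_⟩
  rw [← prependWord_add_length w.1 w.2 t]
  convert hP using 2
  unfold prependBlock
  congr 1
  omega

theorem FrequentSeq.exists_eq_prependBlock (s : FrequentSeq P) :
    ∃ p : Block P × FrequentSeq P, s.1 = prependBlock p.1 p.2.1 := by
  obtain ⟨w, t, h⟩ := _root_.exists_eq_prependBlock s.2.exists
  exact ⟨(w, ⟨t, frequently_of_prependBlock (h ▸ s.2)⟩), h⟩

/-- The first block of a sequence. -/
def FrequentSeq.head (s : FrequentSeq P) : Block P := s.exists_eq_prependBlock.choose.1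

/-- What remains of a sequence after removal of its first block. -/
def FrequentSeq.tail (s : FrequentSeq P) : FrequentSeq P := s.exists_eq_prependBlock.choose.2

theorem FrequentSeq.prependBlock_head_tail (s : FrequentSeq P) :
    prependBlock s.head s.tail.1 = s.1 :=
  s.exists_eq_prependBlock.choose_spec.symm

theorem FrequentSeq.head_tail_of_eq {s : FrequentSeq P} {w : Block P} {t : ℕ → D}
    (h : s.1 = prependBlock w t) : s.head = w ∧ s.tail.1 = t :=
  prependBlock_inj (s.prependBlock_head_tail.trans h)

theorem FrequentSeq.eventually_agree [TopologicalSpace D] [DiscreteTopology D]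
    (s : FrequentSeq P) (n : ℕ) : ∀ᶠ t in nhds s, ∀ j ≤ n, t.1 j = s.1 j := by
  have h : ∀ j ∈ Finset.range (n + 1), ∀ᶠ t : FrequentSeq P in nhds s, t.1 j = s.1 j := by
    intro j _
    have hc : Continuous fun t : FrequentSeq P => t.1 j :=
      (continuous_apply j).comp continuous_subtype_val
    exact hc.continuousAt.eventually_mem (isOpen_discrete {s.1 j} |>.mem_nhds rfl)
  filter_upwards [(Finset.eventually_all _).2 h] with t ht j hj
  exact ht j (Finset.mem_range.2 (Nat.lt_succ_of_le hj))

theorem FrequentSeq.eventually_head_tail [TopologicalSpace D] [DiscreteTopology D]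
    (s : FrequentSeq P) : ∀ᶠ t in nhds s,
      t.head = s.head ∧ t.tail.1 = fun j => t.1 (j + s.head.1.length + 1) := by
  filter_upwards [s.eventually_agree s.head.1.length] with t ht
  refine head_tail_of_eq (eq_prependWord_of_agree s.head.1 s.head.2 (t := s.tail.1) fun j hj => ?_)
  rw [ht j hj, ← s.prependBlock_head_tail]
  rfl

theorem FrequentSeq.continuous_tail [TopologicalSpace D] [DiscreteTopology D] :
    Continuous (tail : FrequentSeq P → FrequentSeq P) := by
  refine continuous_induced_rng.2 (continuous_iff_continuousAt.2 fun s => ?_)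
  have hc : Continuous fun t : FrequentSeq P => fun j => t.1 (j + s.head.1.length + 1) :=
    continuous_pi fun j => (continuous_apply _).comp continuous_subtype_val
  refine hc.continuousAt.congr ?_
  filter_upwards [s.eventually_head_tail] with t ht
  exact ht.2.symm

theorem FrequentSeq.isLocallyConstant_head [TopologicalSpace D] [DiscreteTopology D] :
    IsLocallyConstant (head : FrequentSeq P → Block P) :=
  (IsLocallyConstant.iff_eventually_eq _).2 fun s => s.eventually_head_tail.mono fun _ h => h.1

/-- The sequence of blocks of a sequence. -/
def FrequentSeq.blocks (s : FrequentSeq P) (i : ℕ) : Block P := (tail^[i] s).head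

theorem FrequentSeq.isLocallyConstant_blocks [TopologicalSpace D] [DiscreteTopology D] (i : ℕ) :
    IsLocallyConstant fun s : FrequentSeq P => s.blocks i :=
  isLocallyConstant_head.comp_continuous (continuous_tail.iterate i)

/-- The concatenation of the first `n` blocks of `w`, continued in an arbitrary way. -/
def concatFirst : ℕ → (ℕ → Block P) → ℕ → D
  | 0, w => fun _ => (w 0).2
  | n + 1, w => prependBlock (w 0) (concatFirst n fun i => w (i + 1))

/-- The concatenation of a sequence of blocks. -/
def concat (w : ℕ → Block P) (j : ℕ) : D := concatFirst (j + 1) w j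

theorem concatFirst_agree {n m : ℕ} (h : n ≤ m) (w : ℕ → Block P) :
    ∀ j < n, concatFirst n w j = concatFirst m w j := by
  induction n generalizing m w with
  | zero => intro j hj; omega
  | succ n ih =>
    obtain ⟨m, rfl⟩ : ∃ k, m = k + 1 := ⟨m - 1, by omega⟩
    exact prependWord_agree _ _ (ih (by omega) _)

theorem concat_eq_prependBlock (w : ℕ → Block P) :
    concat w = prependBlock (w 0) (concat fun i => w (i + 1)) := by
  funext j
  refine prependWord_agree _ _ (n := j) (fun i hi => ?_) j (Nat.lt_succ_self j)
  exact (concatFirst_agree (by omega) _ i (Nat.lt_succ_self i)).symm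

theorem frequently_concat (w : ℕ → Block P) : ∃ᶠ j in atTop, P (concat w j) := by
  rw [frequently_atTop]
  intro N
  induction N generalizing w with
  | zero =>
    refine ⟨(w 0).1.length, Nat.zero_le _, ?_⟩
    rw [concat_eq_prependBlock, prependBlock, prependWord_length]
    exact (w 0).2.2
  | succ N ih =>
    obtain ⟨j, hj, hP⟩ := ih fun i => w (i + 1)
    refine ⟨j + (w 0).1.length + 1, by omega, ?_⟩
    rwa [concat_eq_prependBlock, prependBlock, prependWord_add_length]

theorem blocks_concat (w : ℕ → Block P) :
    FrequentSeq.blocks ⟨concat w, frequently_concat w⟩ = w := by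
  funext i
  induction i generalizing w with
  | zero => exact (FrequentSeq.head_tail_of_eq (concat_eq_prependBlock w)).1
  | succ i ih =>
    refine Eq.trans ?_ (ih fun i => w (i + 1))
    rw [FrequentSeq.blocks, Function.iterate_succ_apply, FrequentSeq.blocks]
    congr 2
    exact Subtype.ext (FrequentSeq.head_tail_of_eq (concat_eq_prependBlock w)).2

theorem concat_blocks (s : FrequentSeq P) : concat s.blocks = s.1 := by
  suffices h : ∀ n (s : FrequentSeq P), ∀ j < n, concat s.blocks j = s.1 j from
    funext fun j => h (j + 1) s j (Nat.lt_succ_self j)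
  intro n
  induction n with
  | zero => intro s j hj; omega
  | succ n ih =>
    intro s j hj
    rw [concat_eq_prependBlock, ← s.prependBlock_head_tail]
    exact prependWord_agree _ _ (ih s.tail) j hj

theorem continuous_prependBlock [TopologicalSpace D] (w : Block P) :
    Continuous (prependBlock w) := by
  have hl : ∀ (d : D), Continuous (prependLetter d) := fun d => continuous_pi fun j => by
    cases j with
    | zero => exact continuous_const
    | succ j => exact continuous_apply j
  obtain ⟨l, b⟩ := w
  induction l with
  | nil => exact hl b
  | cons a l ih => exact (hl a).comp ih

theorem continuous_concatFirst [TopologicalSpace D] {W : Type*} [TopologicalSpace W]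
    [DiscreteTopology W] (e : W → Block P) (n : ℕ) :
    Continuous fun v : ℕ → W => concatFirst n fun i => e (v i) := by
  induction n with
  | zero =>
    exact continuous_pi fun _ =>
      (continuous_of_discreteTopology (f := fun x : W => ((e x).2 : D))).comp (continuous_apply 0)
  | succ n ih =>
    have h : Continuous fun p : W × (ℕ → D) => prependBlock (e p.1) p.2 :=
      continuous_prod_of_discrete_left.2 fun x => continuous_prependBlock (e x)
    have hs : Continuous fun (v : ℕ → W) i => v (i + 1) :=
      continuous_pi fun i => continuous_apply (i + 1)
    exact h.comp ((continuous_apply 0).prodMk (ih.comp hs))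

theorem continuous_concat [TopologicalSpace D] {W : Type*} [TopologicalSpace W]
    [DiscreteTopology W] (e : W → Block P) : Continuous fun v : ℕ → W => concat fun i => e (v i) :=
  continuous_pi fun j => (continuous_apply j).comp (continuous_concatFirst e (j + 1))

/-- The sequences that satisfy `P` infinitely often form a space homeomorphic to the sequences of
blocks, where the blocks are numbered by a discrete space. -/
def frequentSeqHomeomorph [TopologicalSpace D] [DiscreteTopology D] {W : Type*}
    [TopologicalSpace W] [DiscreteTopology W] (e : W ≃ Block P) :
    FrequentSeq P ≃ₜ (ℕ → W) where
  toFun s i := e.symm (s.blocks i)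
  invFun v := ⟨concat fun i => e (v i), frequently_concat _⟩
  left_inv s := Subtype.ext (by simpa using concat_blocks s)
  right_inv v := by
    funext i
    simp [blocks_concat]
  continuous_toFun := continuous_pi fun i =>
    ((FrequentSeq.isLocallyConstant_blocks i).comp e.symm).continuous
  continuous_invFun := continuous_induced_rng.2 (continuous_concat e)

theorem nonempty_frequentSeq_homeomorph_nat [TopologicalSpace D] [DiscreteTopology D] [Countable D]
    (hP : {d | P d}.Infinite) : Nonempty (FrequentSeq P ≃ₜ (ℕ → ℕ)) := by
  have : Infinite {d // P d} := hP.to_subtype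
  obtain ⟨e⟩ := nonempty_equiv_of_countable (α := ℕ) (β := Block P)
  exact ⟨frequentSeqHomeomorph e⟩

end Blocks

section DiscreteFactor

variable {X M : Type*} [TopologicalSpace X] [TopologicalSpace M]

/-- A space is the product of a discrete quotient and a space `M` if all classes of the quotient
can be identified with `M`. -/
def DiscreteQuotient.homeomorphProd (Q : DiscreteQuotient X) (f : X → M) (g : Q → M → X)
    (hf : Continuous f) (hg : ∀ d, Continuous (g d)) (hgf : ∀ x, g (Q.proj x) (f x) = x)
    (hQg : ∀ d m, Q.proj (g d m) = d) (hfg : ∀ d m, f (g d m) = m) : X ≃ₜ Q × M where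
  toFun x := (Q.proj x, f x)
  invFun p := g p.1 p.2
  left_inv := hgf
  right_inv p := Prod.ext (hQg p.1 p.2) (hfg p.1 p.2)
  continuous_toFun := Q.proj_continuous.prodMk hf
  continuous_invFun := continuous_prod_of_discrete_left.2 hg

theorem DiscreteQuotient.countable [TopologicalSpace.SeparableSpace X] (Q : DiscreteQuotient X) :
    Countable Q :=
  TopologicalSpace.separableSpace_iff_countable.1
    (Q.proj_surjective.denseRange.separableSpace Q.proj_continuous)

/-- A sequence of pairs is a pair of sequences. -/
def homeomorphSeqProd : (ℕ → X × M) ≃ₜ (ℕ → X) × (ℕ → M) where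
  toEquiv := Equiv.arrowProdEquivProdArrow ℕ (fun _ => X) fun _ => M
  continuous_toFun := by
    dsimp [Equiv.arrowProdEquivProdArrow]
    fun_prop
  continuous_invFun := by
    dsimp [Equiv.arrowProdEquivProdArrow]
    fun_prop

/-- A condition on the first component of a pair cuts out a product. -/
def homeomorphSubtypeProd (p : X → Prop) : {x : X × M // p x.1} ≃ₜ {x // p x} × M where
  toFun x := (⟨x.1.1, x.2⟩, x.1.2)
  invFun x := ⟨(x.1.1, x.2), x.1.2⟩
  continuous_toFun := by fun_prop
  continuous_invFun := by fun_prop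

theorem nonempty_homeomorph_seq_of_homeomorph_prod {D : Type*} [TopologicalSpace D]
    [DiscreteTopology D] [Countable D] [Infinite D] (e : X ≃ₜ D × M) :
    Nonempty ((ℕ → X) ≃ₜ (ℕ → ℕ) × (ℕ → M)) := by
  obtain ⟨c⟩ := nonempty_equiv_of_countable (α := D) (β := ℕ)
  exact ⟨(Homeomorph.piCongrRight fun _ => e).trans <| homeomorphSeqProd.trans <|
    (Homeomorph.piCongrRight fun _ => c.toHomeomorphOfDiscrete).prodCongr (Homeomorph.refl _)⟩

theorem nonempty_homeomorph_frequently_of_homeomorph_prod {D : Type*} [TopologicalSpace D]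
    [DiscreteTopology D] [Countable D] (e : X ≃ₜ D × M) {P : D → Prop}
    (hP : {d | P d}.Infinite) :
    Nonempty ({x : ℕ → X // ∃ᶠ j in atTop, P (e (x j)).1} ≃ₜ (ℕ → ℕ) × (ℕ → M)) := by
  obtain ⟨c⟩ := nonempty_frequentSeq_homeomorph_nat hP
  let φ : (ℕ → X) ≃ₜ (ℕ → D) × (ℕ → M) :=
    (Homeomorph.piCongrRight fun _ => e).trans homeomorphSeqProd
  exact ⟨(φ.subtype fun _ => Iff.rfl).trans <|
    (homeomorphSubtypeProd fun s : ℕ → D => ∃ᶠ j in atTop, P (s j)).trans <|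
      c.prodCongr (Homeomorph.refl _)⟩

end DiscreteFactor

section Ultrametric

variable {F : Type*} [NontriviallyNormedField F]

variable (F) in
/-- The closed unit ball without the point `1`. -/
abbrev PuncturedBall : Type _ := ↥(Metric.closedBall (0 : F) 1 \ {1})

theorem one_sub_ne_zero (y : PuncturedBall F) : (1 : F) - y ≠ 0 :=
  sub_ne_zero.2 fun h => y.2.2 h.symm

theorem norm_one_sub_pos (y : PuncturedBall F) : 0 < ‖(1 : F) - y‖ :=
  norm_pos_iff.2 (one_sub_ne_zero y)

variable [IsUltrametricDist F]

theorem norm_eq_of_norm_sub_lt {x y : F} (h : ‖x - y‖ < ‖x‖) : ‖x‖ = ‖y‖ :=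
  IsUltrametricDist.norm_eq_of_add_norm_lt_max (y := -y) (by
    rw [← sub_eq_add_neg]
    exact h.trans_le (le_max_left _ _)) |>.trans (norm_neg y)

theorem norm_sub_lt_of_lt {x y z : F} {r : ℝ} (h₁ : ‖x - y‖ < r) (h₂ : ‖y - z‖ < r) :
    ‖x - z‖ < r := by
  rw [← sub_add_sub_cancel x y z]
  exact (IsUltrametricDist.norm_add_le_max _ _).trans_lt (max_lt h₁ h₂)

variable (F) in
/-- The classes of `F` modulo its open unit ball. -/
def ballClasses : DiscreteQuotient F where
  r x y := ‖x - y‖ < 1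
  iseqv :=
    { refl := fun x => by simp
      symm := fun h => by rwa [norm_sub_rev]
      trans := norm_sub_lt_of_lt }
  isOpen_setOfPred_rel x := isOpen_lt (by fun_prop) continuous_const

theorem ballClasses_proj_eq_iff {x y : F} :
    (ballClasses F).proj x = (ballClasses F).proj y ↔ ‖x - y‖ < 1 :=
  Quotient.eq''

theorem norm_sub_out_lt (x : F) : ‖x - ((ballClasses F).proj x).out‖ < 1 :=
  ballClasses_proj_eq_iff.1 (Quotient.out_eq' _).symm

variable (F) in
/-- `F` is the product of its classes modulo the open unit ball with that ball. -/
def homeomorphBallClassesProd : F ≃ₜ ballClasses F × Metric.ball (0 : F) 1 :=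
  (ballClasses F).homeomorphProd
    (fun x => ⟨x - ((ballClasses F).proj x).out, mem_ball_zero_iff.2 (norm_sub_out_lt x)⟩)
    (fun d m => d.out + m)
    (continuous_induced_rng.2 <| continuous_id.sub <|
      continuous_of_discreteTopology.comp (ballClasses F).proj_continuous)
    (fun d => by fun_prop)
    (fun x => by simp)
    (fun d m => by
      conv_rhs => rw [← Quotient.out_eq' d]
      exact ballClasses_proj_eq_iff.2 (by simpa using mem_ball_zero_iff.1 m.2))
    (fun d m => by
      have h : (ballClasses F).proj (d.out + m) = d := by
        conv_rhs => rw [← Quotient.out_eq' d]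
        exact ballClasses_proj_eq_iff.2 (by simpa using mem_ball_zero_iff.1 m.2)
      exact Subtype.ext (by simp [h]))

theorem infinite_ballClasses : Infinite (ballClasses F) := by
  obtain ⟨c, hc⟩ := NormedField.exists_one_lt_norm F
  refine Infinite.of_injective (fun k : ℕ => (ballClasses F).proj (c ^ k)) fun k l h => ?_
  have h' := norm_eq_of_norm_sub_lt
    ((ballClasses_proj_eq_iff.1 h).trans_le (by
      rw [norm_pow]; exact one_le_pow₀ hc.le))
  rw [norm_pow, norm_pow] at h'
  exact (pow_right_injective₀ (by linarith) hc.ne') h'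

theorem norm_one_sub_le {y : F} (hy : ‖y‖ ≤ 1) : ‖1 - y‖ ≤ 1 := by
  rw [sub_eq_add_neg]
  exact (IsUltrametricDist.norm_add_le_max _ _).trans (by simp [hy])

/-- The element `1 - z` of the punctured ball. -/
def oneSub (z : F) (h0 : z ≠ 0) (h1 : ‖z‖ ≤ 1) : PuncturedBall F :=
  ⟨1 - z, mem_closedBall_zero_iff.2 (norm_one_sub_le h1), by simpa using h0⟩

theorem norm_one_sub_eq_of_norm_sub_lt {y z : F} (h : ‖y - z‖ < ‖1 - y‖) :
    ‖1 - y‖ = ‖1 - z‖ :=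
  norm_eq_of_norm_sub_lt (by rwa [sub_sub_sub_cancel_left, norm_sub_rev])

variable (F) in
/-- The classes of elements `y` for which `1 - y` have the same leading term. -/
def leadingClasses : DiscreteQuotient (PuncturedBall F) where
  r y z := ‖(y : F) - z‖ < ‖1 - (y : F)‖
  iseqv :=
    { refl := fun y => by simpa using one_sub_ne_zero y
      symm := fun h => by rwa [norm_sub_rev, ← norm_one_sub_eq_of_norm_sub_lt h]
      trans := fun h₁ h₂ =>
        norm_sub_lt_of_lt h₁ (h₂.trans_eq (norm_one_sub_eq_of_norm_sub_lt h₁).symm) }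
  isOpen_setOfPred_rel y := isOpen_lt (by fun_prop) continuous_const

theorem leadingClasses_proj_eq_iff {y z : PuncturedBall F} :
    (leadingClasses F).proj y = (leadingClasses F).proj z ↔ ‖(y : F) - z‖ < ‖1 - (y : F)‖ :=
  Quotient.eq''

/-- The norm of `1 - y`, as a function of the class of `y`. -/
def leadingNorm (d : leadingClasses F) : ℝ := ‖1 - (d.out : F)‖

theorem norm_sub_leading_out_lt (y : PuncturedBall F) :
    ‖(y : F) - ((leadingClasses F).proj y).out‖ < ‖1 - (y : F)‖ :=
  leadingClasses_proj_eq_iff.1 (Quotient.out_eq' _).symm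

theorem leadingNorm_proj (y : PuncturedBall F) :
    leadingNorm ((leadingClasses F).proj y) = ‖1 - (y : F)‖ :=
  (norm_one_sub_eq_of_norm_sub_lt (norm_sub_leading_out_lt y)).symm

theorem norm_one_add_eq {m : F} (hm : ‖m‖ < 1) : ‖1 + m‖ = 1 := by
  have h : ‖(1 : F) - (1 + m)‖ < ‖(1 : F)‖ := by simpa using hm
  exact (norm_eq_of_norm_sub_lt h).symm.trans norm_one

/-- The element `y` of the class `d` with quotient `(1 - y) / (1 - d.out) = 1 + m`. -/
def leadingTranslate (d : leadingClasses F) (m : Metric.ball (0 : F) 1) : PuncturedBall F :=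
  oneSub ((1 - (d.out : F)) * (1 + m))
    (mul_ne_zero (one_sub_ne_zero _) (norm_pos_iff.1 (by
      rw [norm_one_add_eq (mem_ball_zero_iff.1 m.2)]; exact one_pos)))
    (by
      rw [norm_mul, norm_one_add_eq (mem_ball_zero_iff.1 m.2), mul_one]
      exact norm_one_sub_le (mem_closedBall_zero_iff.1 d.out.2.1))

theorem coe_leadingTranslate (d : leadingClasses F) (m : Metric.ball (0 : F) 1) :
    (leadingTranslate d m : F) = 1 - (1 - (d.out : F)) * (1 + m) :=
  rfl

theorem leadingClasses_proj_translate (d : leadingClasses F) (m : Metric.ball (0 : F) 1) :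
    (leadingClasses F).proj (leadingTranslate d m) = d := by
  conv_rhs => rw [← Quotient.out_eq' d]
  refine (leadingClasses_proj_eq_iff.2 ?_).symm
  have h : (d.out : F) - leadingTranslate d m = (1 - (d.out : F)) * m := by
    rw [coe_leadingTranslate]; ring
  rw [h, norm_mul]
  exact mul_lt_of_lt_one_right (norm_one_sub_pos _) (mem_ball_zero_iff.1 m.2)

variable (F) in
/-- The punctured ball is the product of its leading classes with the open unit ball. -/
def homeomorphLeadingClassesProd :
    PuncturedBall F ≃ₜ leadingClasses F × Metric.ball (0 : F) 1 :=
  (leadingClasses F).homeomorphProd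
    (fun y => ⟨(1 - (y : F)) / (1 - (((leadingClasses F).proj y).out : F)) - 1, by
      rw [mem_ball_zero_iff, div_sub_one (one_sub_ne_zero _), norm_div, sub_sub_sub_cancel_left,
        norm_sub_rev, div_lt_one (norm_one_sub_pos _)]
      exact (norm_sub_leading_out_lt y).trans_eq (leadingNorm_proj y).symm⟩)
    leadingTranslate
    (continuous_induced_rng.2 <| Continuous.sub
      (Continuous.div (by fun_prop)
        ((continuous_of_discreteTopology
          (f := fun d : leadingClasses F => 1 - (d.out : F))).comp
            (leadingClasses F).proj_continuous)
        fun _ => one_sub_ne_zero _) continuous_const)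
    (fun d => continuous_induced_rng.2 <|
      show Continuous fun m : Metric.ball (0 : F) 1 => 1 - (1 - (d.out : F)) * (1 + m) by fun_prop)
    (fun y => Subtype.ext (by
      rw [coe_leadingTranslate, add_sub_cancel, mul_div_cancel₀ _ (one_sub_ne_zero _)]
      ring))
    leadingClasses_proj_translate
    (fun d m => Subtype.ext (by
      simp only [leadingClasses_proj_translate]
      rw [coe_leadingTranslate, sub_sub_cancel, mul_div_cancel_left₀ _ (one_sub_ne_zero _),
        add_sub_cancel_left]))

theorem infinite_leadingNorm_lt_one : {d : leadingClasses F | leadingNorm d < 1}.Infinite := by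
  obtain ⟨c, h0, h1⟩ := NormedField.exists_norm_lt_one F
  let y : ℕ → PuncturedBall F := fun k =>
    oneSub (c ^ (k + 1)) (pow_ne_zero _ (norm_pos_iff.1 h0))
      (by rw [norm_pow]; exact pow_le_one₀ h0.le h1.le)
  have hy : ∀ k, leadingNorm ((leadingClasses F).proj (y k)) = ‖c‖ ^ (k + 1) := fun k => by
    rw [leadingNorm_proj, ← norm_pow]
    exact congrArg norm (sub_sub_cancel 1 (c ^ (k + 1)))
  refine Set.infinite_of_injective_forall_mem (f := fun k => (leadingClasses F).proj (y k))
    (fun k l h => ?_) fun k => ?_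
  · have h' := congrArg leadingNorm h
    simp only [hy] at h'
    exact Nat.succ_injective (pow_right_injective₀ h0 h1.ne h')
  · change leadingNorm _ < 1
    rw [hy]
    exact pow_lt_one₀ h0.le h1 (Nat.succ_ne_zero k)

variable (F) in
theorem exists_norm_le_of_norm_lt_one [LocallyCompactSpace F] : ∃ c < (1 : ℝ), ∀ x : F, ‖x‖ < 1 → ‖x‖ ≤ c := by
  have : ProperSpace F := ProperSpace.of_locallyCompactSpace F
  have hc : IsCompact (Metric.ball (0 : F) 1) :=
    Metric.isCompact_of_isClosed_isBounded (IsUltrametricDist.isClosed_ball 0 1)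
      Metric.isBounded_ball
  obtain ⟨x, hx, hmax⟩ := hc.exists_isMaxOn ⟨0, by simp⟩ continuous_norm.continuousOn
  exact ⟨‖x‖, mem_ball_zero_iff.1 hx, fun y hy => hmax (mem_ball_zero_iff.2 hy)⟩

theorem mem_sStar_iff [LocallyCompactSpace F] (y : sTilde F) :
    y ∈ sStar F ↔ ∃ᶠ j in atTop, ‖1 - (y j : F)‖ < 1 := by
  have hle : ∀ j, ‖1 - (y j : F)‖ ≤ 1 := fun j =>
    norm_one_sub_le (mem_closedBall_zero_iff.1 (y j).2.1)
  set p : ℕ → ℝ := fun m => ‖∏ j ∈ Finset.range m, (1 - (y j : F))‖ with hp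
  have hsucc : ∀ m, p (m + 1) = p m * ‖1 - (y m : F)‖ := fun m => by
    simp only [hp, Finset.prod_range_succ, norm_mul]
  have hpos : ∀ m, 0 < p m := fun m =>
    norm_pos_iff.2 (Finset.prod_ne_zero_iff.2 fun j _ => one_sub_ne_zero (y j))
  constructor
  · rintro ⟨h, -⟩ hf
    obtain ⟨n, hn⟩ := eventually_atTop.1 hf
    have hconst : ∀ m ≥ n, p m = p n := fun m hm => by
      induction m, hm using Nat.le_induction with
      | base => rfl
      | succ m hm ih => rw [hsucc, ih, (hle m).antisymm (not_lt.1 (hn m hm)), mul_one]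
    have h₁ : Tendsto p atTop (nhds (p n)) :=
      tendsto_const_nhds.congr' (eventually_atTop.2 ⟨n, fun m hm => (hconst m hm).symm⟩)
    exact (hpos n).ne' (tendsto_nhds_unique h₁ (tendsto_zero_iff_norm_tendsto_zero.1 h))
  · intro h
    refine ⟨tendsto_zero_iff_norm_tendsto_zero.2 ?_, fun hU => ?_⟩
    · change Tendsto p atTop (nhds 0)
      obtain ⟨c, hc1, hc⟩ := exists_norm_le_of_norm_lt_one F
      have hanti : Antitone p := antitone_nat_of_succ_le fun m => by
        rw [hsucc]
        exact mul_le_of_le_one_right (hpos m).le (hle m)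
      have hlim := tendsto_atTop_ciInf hanti
        ⟨0, by rintro _ ⟨m, rfl⟩; exact (hpos m).le⟩
      set L := ⨅ m, p m
      have hL0 : 0 ≤ L := ge_of_tendsto' hlim fun m => (hpos m).le
      have hL : L ≤ L * c :=
        le_of_tendsto_of_tendsto_of_frequently ((tendsto_add_atTop_iff_nat 1).2 hlim)
          (hlim.mul_const c) (h.mono fun m hm => by
            rw [hsucc]
            exact mul_le_mul_of_nonneg_left (hc _ hm) (hpos m).le)
      have : L = 0 := by nlinarith
      rwa [this] at hlim
    · obtain ⟨n, hn⟩ := Set.mem_iUnion.1 hU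
      obtain ⟨j, hj, hlt⟩ := frequently_atTop.1 h n
      rw [hn j hj, sub_zero, norm_one] at hlt
      exact lt_irrefl _ hlt

end Ultrametric

/-- Let `K` be a locally compact field with a complete
non-Archimedean multiplicative norm whose value group is nontrivial.  The spaces `s_*`
and `s̃` are homeomorphic; consequently `s_*` is homeomorphic to `K^ℕ` with the
Tychonoff product topology. -/
theorem sStar_homeomorph_sTilde_and_pi :
    Nonempty (↥(sStar K) ≃ₜ sTilde K) ∧ Nonempty (↥(sStar K) ≃ₜ (ℕ → K)) := by
  have : ProperSpace K := ProperSpace.of_locallyCompactSpace K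
  have := (ballClasses K).countable
  have := (leadingClasses K).countable
  have := infinite_ballClasses (F := K)
  have : Infinite (leadingClasses K) :=
    (infinite_leadingNorm_lt_one (F := K)).to_subtype.of_injective _ Subtype.val_injective
  obtain ⟨e₁⟩ := nonempty_homeomorph_frequently_of_homeomorph_prod
    (homeomorphLeadingClassesProd K) infinite_leadingNorm_lt_one
  obtain ⟨e₂⟩ := nonempty_homeomorph_seq_of_homeomorph_prod (homeomorphLeadingClassesProd K)
  obtain ⟨e₃⟩ := nonempty_homeomorph_seq_of_homeomorph_prod (homeomorphBallClassesProd K)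
  have e₀ : ↥(sStar K) ≃ₜ (ℕ → ℕ) × (ℕ → Metric.ball (0 : K) 1) :=
    ((Homeomorph.refl _).subtype fun y => (mem_sStar_iff y).trans <| by
      simp only [← leadingNorm_proj]
      rfl).trans e₁
  exact ⟨⟨e₀.trans e₂.symm⟩, ⟨e₀.trans e₃.symm⟩⟩

end
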